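/- Let X ⊆ ℤ² be a κ-connected digital image with m points, κ ∈ {4,8}. Suppose there exists a digital simple closed κ-curve C_m with exactly m points and X is digitally homotopy equivalent to C_m. Then: for κ = 4, TC(X,4) = 1 if m < 8 and TC(X,4) = 2 if m ≥ 8; for κ = 8, TC(X,8) = 1 if m < 6 and TC(X,8) = 2 if m ≥ 6. -/

import Mathlib

/-! Basic digital topology definitions (digital images, adjacencies, continuity,
homotopy, contractibility, reducibility, simple closed curves, loops,
digital (higher) topological complexity). -/

/-- 2-adjacency on `ℤ`. -/
def adjZ (a b : ℤ) : Prop := |a - b| = 1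

/-- 4-adjacency (`c₁`) on `ℤ²`. -/
def adj4 (p q : ℤ × ℤ) : Prop :=
  (|p.1 - q.1| = 1 ∧ p.2 = q.2) ∨ (p.1 = q.1 ∧ |p.2 - q.2| = 1)

/-- 8-adjacency (`c₂`) on `ℤ²`. -/
def adj8 (p q : ℤ × ℤ) : Prop :=
  p ≠ q ∧ |p.1 - q.1| ≤ 1 ∧ |p.2 - q.2| ≤ 1

/-- The adjacency relation on `ℤ²` named by `κ ∈ {4, 8}`. -/
def adjK (κ : ℕ) : ℤ × ℤ → ℤ × ℤ → Prop := if κ = 4 then adj4 else adj8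

/-- The `c_k`-adjacency on `ℤⁿ`: distinct points, coordinates differing by `1` in at
most `k` indices, all other coordinates equal. -/
def cAdj (n k : ℕ) (x y : Fin n → ℤ) : Prop :=
  x ≠ y ∧ ((Finset.univ.filter fun i => x i ≠ y i).card ≤ k) ∧
    ∀ i, x i ≠ y i → |x i - y i| = 1

/-- A digital path of length `len`, given by a function on `ℤ` (only its values on
`[0, len]` matter). -/
structure DigPath (α : Type) where
  len : ℕ
  toFun : ℤ → α

/-- An element `(f, p₁, …, pₙ)` of (the ambient type of) `Sₙ(X)`. -/
structure SnElt (α : Type) (n : ℕ) where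
  path : DigPath α
  pts : Fin n → α

section

variable {α β : Type} (A : α → α → Prop) (B : β → β → Prop)

/-- `f` maps the digital image `X` into the digital image `Y`. -/
def DigMapsTo (X : Set α) (Y : Set β) (f : α → β) : Prop := ∀ x ∈ X, f x ∈ Y

/-- Digital `(A,B)`-continuity of `f` on `X`: adjacent points go to equal or
adjacent points. -/
def DigContinuousOn (X : Set α) (f : α → β) : Prop :=
  ∀ x ∈ X, ∀ x' ∈ X, A x x' → f x = f x' ∨ B (f x) (f x')

/-- Digital homotopy between `f` and `g` as maps from `(X, A)` to `(Y, B)`. -/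
def DigHomotopic (X : Set α) (Y : Set β) (f g : α → β) : Prop :=
  ∃ (m : ℕ) (F : α → ℤ → β),
    (∀ x ∈ X, ∀ t ∈ Set.Icc (0 : ℤ) (m : ℤ), F x t ∈ Y) ∧
    (∀ x ∈ X, F x 0 = f x) ∧
    (∀ x ∈ X, F x (m : ℤ) = g x) ∧
    (∀ t ∈ Set.Icc (0 : ℤ) (m : ℤ), DigContinuousOn A B X fun x => F x t) ∧
    (∀ x ∈ X, ∀ t ∈ Set.Icc (0 : ℤ) (m : ℤ), ∀ t' ∈ Set.Icc (0 : ℤ) (m : ℤ),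
      adjZ t t' → F x t = F x t' ∨ B (F x t) (F x t'))

/-- The given map `f : (X, A) → (Y, B)` is a digital homotopy equivalence. -/
def IsDigHomotopyEquiv (X : Set α) (Y : Set β) (f : α → β) : Prop :=
  DigMapsTo X Y f ∧ DigContinuousOn A B X f ∧
    ∃ g : β → α, DigMapsTo Y X g ∧ DigContinuousOn B A Y g ∧
      DigHomotopic A A X X (g ∘ f) id ∧ DigHomotopic B B Y Y (f ∘ g) id

/-- `(X, A)` and `(Y, B)` are digitally homotopy equivalent. -/
def DigHomotopyEquiv (X : Set α) (Y : Set β) : Prop :=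
  ∃ f : α → β, IsDigHomotopyEquiv A B X Y f

/-- `(X, A)` is digitally contractible. -/
def DigContractible (X : Set α) : Prop :=
  ∃ x₀ ∈ X, DigHomotopic A A X X id fun _ => x₀

/-- `(X, A)` is digitally connected. -/
def DigConnected (X : Set α) : Prop :=
  ∀ x ∈ X, ∀ y ∈ X, Relation.ReflTransGen (fun a b => a ∈ X ∧ b ∈ X ∧ A a b) x y

/-- `(X, A)` is reducible: digitally homotopy equivalent to a digital image
(a subset of some `ℤⁿ` with a `c_k`-adjacency) with strictly fewer points. -/
def Reducible (X : Set α) : Prop :=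
  ∃ (n k : ℕ) (Y : Set (Fin n → ℤ)), 1 ≤ k ∧ k ≤ n ∧ Y.Finite ∧
    Y.ncard < X.ncard ∧ DigHomotopyEquiv A (cAdj n k) X Y

/-- Value of a path at time `t`, extended past its endpoint by its final value. -/
def DigPath.eval (p : DigPath α) (t : ℤ) : α := p.toFun (min t (p.len : ℤ))

/-- `p` is a digital path in `(X, A)`. -/
def IsDigPath (X : Set α) (p : DigPath α) : Prop :=
  (∀ t ∈ Set.Icc (0 : ℤ) (p.len : ℤ), p.toFun t ∈ X) ∧
    ∀ t ∈ Set.Icc (0 : ℤ) (p.len : ℤ), ∀ t' ∈ Set.Icc (0 : ℤ) (p.len : ℤ),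
      adjZ t t' → p.toFun t = p.toFun t' ∨ A (p.toFun t) (p.toFun t')

/-- Adjacency of digital paths in `PX`: after extending the shorter one by its final
value, values at every time are equal or adjacent. -/
def pathAdj (p q : DigPath α) : Prop :=
  ∀ t ∈ Set.Icc (0 : ℤ) ((max p.len q.len : ℕ) : ℤ),
    p.eval t = q.eval t ∨ A (p.eval t) (q.eval t)

/-- Product adjacency on `X × X`. -/
def prodAdj (u v : α × α) : Prop :=
  u ≠ v ∧ (u.1 = v.1 ∨ A u.1 v.1) ∧ (u.2 = v.2 ∨ A u.2 v.2)

/-- `TCle A X k`: `X × X` is covered by `k` subsets, each admitting a digitally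
continuous motion planning section of `π : PX → X × X`. -/
def TCle (X : Set α) (k : ℕ) : Prop :=
  ∃ U : Fin k → Set (α × α),
    (⋃ j, U j) = X ×ˢ X ∧
    ∀ j, ∃ s : α × α → DigPath α,
      (∀ u ∈ U j, IsDigPath A X (s u)) ∧
      DigContinuousOn (prodAdj A) (pathAdj A) (U j) s ∧
      ∀ u ∈ U j, (s u).toFun 0 = u.1 ∧ (s u).toFun ((s u).len : ℤ) = u.2

/-- The digital topological complexity `TC(X, A)` (`∞` if no finite cover works). -/
noncomputable def digTC (X : Set α) : ℕ∞ :=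
  sInf {N : ℕ∞ | ∃ k : ℕ, N = (k : ℕ∞) ∧ TCle A X k}

/-- Membership in `Sₙ(X)`: the path lies in `X` and each marked point is in its image. -/
def InSn {n : ℕ} (X : Set α) (s : SnElt α n) : Prop :=
  IsDigPath A X s.path ∧
    ∀ i, ∃ t ∈ Set.Icc (0 : ℤ) (s.path.len : ℤ), s.path.toFun t = s.pts i

/-- Adjacency on `Sₙ(X)`. -/
def snAdj {n : ℕ} (s s' : SnElt α n) : Prop :=
  s ≠ s' ∧ pathAdj A s.path s'.path ∧
    ∀ i, s.pts i = s'.pts i ∨ A (s.pts i) (s'.pts i)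

/-- Product adjacency on `Xⁿ`. -/
def prodAdjN {n : ℕ} (u v : Fin n → α) : Prop :=
  u ≠ v ∧ ∀ i, u i = v i ∨ A (u i) (v i)

/-- `TCnle A X n k`: `Xⁿ` is covered by `k` subsets, each admitting a digitally
continuous section of `eₙ' : Sₙ(X) → Xⁿ`. -/
def TCnle (X : Set α) (n k : ℕ) : Prop :=
  ∃ U : Fin k → Set (Fin n → α),
    (⋃ j, U j) = {u : Fin n → α | ∀ i, u i ∈ X} ∧
    ∀ j, ∃ s : (Fin n → α) → SnElt α n,
      (∀ u ∈ U j, InSn A X (s u)) ∧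
      DigContinuousOn (prodAdjN A) (snAdj A) (U j) s ∧
      ∀ u ∈ U j, (s u).pts = u

/-- The digital higher topological complexity `TCₙ(X, A)`, i.e. the digital Schwarz
genus of `eₙ' : Sₙ(X) → Xⁿ`. -/
noncomputable def digTCn (X : Set α) (n : ℕ) : ℕ∞ :=
  sInf {N : ℕ∞ | ∃ k : ℕ, N = (k : ℕ∞) ∧ TCnle A X n k}

/-- `C` is a digital simple closed `A`-curve with `m` points. -/
def IsSimpleClosedCurve (C : Set α) (m : ℕ) : Prop :=
  4 ≤ m ∧ ∃ f : ℤ → α,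
    C = f '' Set.Icc (0 : ℤ) ((m : ℤ) - 1) ∧
    Set.InjOn f (Set.Icc (0 : ℤ) ((m : ℤ) - 1)) ∧
    (∀ t ∈ Set.Icc (0 : ℤ) ((m : ℤ) - 1), ∀ t' ∈ Set.Icc (0 : ℤ) ((m : ℤ) - 1),
      adjZ t t' → f t = f t' ∨ A (f t) (f t')) ∧
    A (f 0) (f ((m : ℤ) - 1)) ∧
    ∀ t ∈ Set.Icc (0 : ℤ) ((m : ℤ) - 1), ∀ t' ∈ Set.Icc (0 : ℤ) ((m : ℤ) - 1),
      A (f t) (f t') → f t' = f ((t - 1) % (m : ℤ)) ∨ f t' = f ((t + 1) % (m : ℤ))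

/-- Adjacency on the digital `m`-cycle `ℤ/mℤ`: `i` adjacent to `i ± 1`. -/
def cmAdj (m : ℕ) (i j : ZMod m) : Prop := i ≠ j ∧ (j = i + 1 ∨ i = j + 1)

/-- The set of digital `m`-loops in `(X, A)`. -/
def mLoops (X : Set α) (m : ℕ) : Set (ZMod m → α) :=
  {f | (∀ i, f i ∈ X) ∧ ∀ i j, cmAdj m i j → f i = f j ∨ A (f i) (f j)}

/-- `Lnum A X m` = the number of digital homotopy classes of `m`-loops in `(X, A)`. -/
noncomputable def Lnum (X : Set α) (m : ℕ) : ℕ :=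
  Set.ncard {S : Set (ZMod m → α) | ∃ f ∈ mLoops A X m,
    S = {g | g ∈ mLoops A X m ∧ DigHomotopic (cmAdj m) A Set.univ X f g}}

end

theorem adjZ_iff {a b : ℤ} : adjZ a b ↔ a = b + 1 ∨ b = a + 1 := by
  rw [adjZ, abs_eq zero_le_one]
  omega

section Homotopy

variable {α β γ : Type} {A : α → α → Prop} {B : β → β → Prop} {D : γ → γ → Prop}

theorem DigHomotopic.of_eqOn {X : Set α} {Y : Set β} {f g : α → β} (hf : DigMapsTo X Y f)
    (hc : DigContinuousOn A B X f) (h : ∀ x ∈ X, f x = g x) : DigHomotopic A B X Y f g :=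
  ⟨0, fun x _ => f x, fun x hx _ _ => hf x hx, fun _ _ => rfl, h, fun _ _ => hc,
    fun _ _ _ _ _ _ _ => Or.inl rfl⟩

theorem DigHomotopic.symm {X : Set α} {Y : Set β} {f g : α → β}
    (h : DigHomotopic A B X Y f g) : DigHomotopic A B X Y g f := by
  obtain ⟨m, F, h1, h2, h3, h4, h5⟩ := h
  have key : ∀ t ∈ Set.Icc (0 : ℤ) m, (m : ℤ) - t ∈ Set.Icc (0 : ℤ) m := by
    intro t ht
    rw [Set.mem_Icc] at ht ⊢
    omega
  refine ⟨m, fun x t => F x (m - t), fun x hx t ht => h1 x hx _ (key t ht),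
    fun x hx => by simpa using h3 x hx, fun x hx => by simpa using h2 x hx,
    fun t ht => h4 _ (key t ht), fun x hx t ht t' ht' ha => h5 x hx _ (key t ht) _ (key t' ht') ?_⟩
  unfold adjZ at ha ⊢
  rw [← ha, abs_sub_comm t t']
  congr 1
  ring

theorem DigHomotopic.trans {X : Set α} {Y : Set β} {f g h : α → β}
    (hfg : DigHomotopic A B X Y f g) (hgh : DigHomotopic A B X Y g h) :
    DigHomotopic A B X Y f h := by
  obtain ⟨m, F, h1, h2, h3, h4, h5⟩ := hfg
  obtain ⟨n, G, k1, k2, k3, k4, k5⟩ := hgh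
  set K : α → ℤ → β := fun x t => if t ≤ m then F x t else G x (t - m) with hK
  have left : ∀ x t, t ≤ (m : ℤ) → K x t = F x t := fun x t ht => if_pos ht
  have right : ∀ x ∈ X, ∀ t, (m : ℤ) ≤ t → K x t = G x (t - m) := by
    intro x hx t ht
    rcases ht.lt_or_eq with ht | rfl
    · exact if_neg (by omega)
    · rw [left x _ le_rfl, h3 x hx, sub_self, k2 x hx]
  refine ⟨m + n, K, ?_, ?_, ?_, ?_, ?_⟩
  · intro x hx t ht
    rw [Set.mem_Icc] at ht
    push_cast at ht
    rcases le_total t m with hle | hle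
    · rw [left x t hle]
      exact h1 x hx t ⟨ht.1, hle⟩
    · rw [right x hx t hle]
      exact k1 x hx _ ⟨by omega, by omega⟩
  · intro x hx
    rw [left x 0 (by omega), h2 x hx]
  · intro x hx
    rw [right x hx _ (by push_cast; omega), ← k3 x hx]
    congr 1
    push_cast
    ring
  · intro t ht x hx x' hx' ha
    rw [Set.mem_Icc] at ht
    push_cast at ht
    rcases le_total t m with hle | hle
    · simp only [left _ t hle]
      exact h4 t ⟨ht.1, hle⟩ x hx x' hx' ha
    · simp only [right x hx t hle, right x' hx' t hle]
      exact k4 _ ⟨by omega, by omega⟩ x hx x' hx' ha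
  · intro x hx t ht t' ht' ha
    rw [Set.mem_Icc] at ht ht'
    push_cast at ht ht'
    have ha' := adjZ_iff.1 ha
    by_cases hle : t ≤ m ∧ t' ≤ m
    · rw [left x t hle.1, left x t' hle.2]
      exact h5 x hx t ⟨ht.1, hle.1⟩ t' ⟨ht'.1, hle.2⟩ ha
    · rw [right x hx t (by omega), right x hx t' (by omega)]
      refine k5 x hx _ ⟨by omega, by omega⟩ _ ⟨by omega, by omega⟩ ?_
      unfold adjZ at ha ⊢
      rw [← ha]
      congr 1
      ring

theorem DigHomotopic.postcomp {X : Set α} {Y : Set β} {Z : Set γ} {f g : α → β} {h : β → γ}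
    (hfg : DigHomotopic A B X Y f g) (hm : DigMapsTo Y Z h) (hc : DigContinuousOn B D Y h) :
    DigHomotopic A D X Z (h ∘ f) (h ∘ g) := by
  obtain ⟨m, F, h1, h2, h3, h4, h5⟩ := hfg
  refine ⟨m, fun x t => h (F x t), fun x hx t ht => hm _ (h1 x hx t ht),
    fun x hx => congrArg h (h2 x hx), fun x hx => congrArg h (h3 x hx), ?_, ?_⟩
  · intro t ht x hx x' hx' ha
    rcases h4 t ht x hx x' hx' ha with he | he
    · exact Or.inl (congrArg h he)
    · exact hc _ (h1 x hx t ht) _ (h1 x' hx' t ht) he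
  · intro x hx t ht t' ht' ha
    rcases h5 x hx t ht t' ht' ha with he | he
    · exact Or.inl (congrArg h he)
    · exact hc _ (h1 x hx t ht) _ (h1 x hx t' ht') he

theorem DigHomotopic.precomp {X : Set α} {Y : Set β} {Z : Set γ} {f g : α → β} {h : γ → α}
    (hfg : DigHomotopic A B X Y f g) (hm : DigMapsTo Z X h) (hc : DigContinuousOn D A Z h) :
    DigHomotopic D B Z Y (f ∘ h) (g ∘ h) := by
  obtain ⟨m, F, h1, h2, h3, h4, h5⟩ := hfg
  refine ⟨m, fun z t => F (h z) t, fun z hz => h1 _ (hm z hz), fun z hz => h2 _ (hm z hz),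
    fun z hz => h3 _ (hm z hz), ?_, fun z hz => h5 _ (hm z hz)⟩
  intro t ht z hz z' hz' ha
  rcases hc z hz z' hz' ha with he | he
  · exact Or.inl (congrArg (F · t) he)
  · exact h4 t ht _ (hm z hz) _ (hm z' hz') he

theorem digContinuousOn_comp {X : Set α} {Y : Set β} {f : α → β} {g : β → γ}
    (hm : DigMapsTo X Y f) (hf : DigContinuousOn A B X f) (hg : DigContinuousOn B D Y g) :
    DigContinuousOn A D X (g ∘ f) := by
  intro x hx x' hx' ha
  rcases hf x hx x' hx' ha with he | he
  · exact Or.inl (congrArg g he)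
  · exact hg _ (hm x hx) _ (hm x' hx') he

theorem digContinuousOn_fst (U : Set (α × α)) : DigContinuousOn (prodAdj A) A U Prod.fst :=
  fun _ _ _ _ h => h.2.1

theorem digContinuousOn_snd (U : Set (α × α)) : DigContinuousOn (prodAdj A) A U Prod.snd :=
  fun _ _ _ _ h => h.2.2

theorem digContinuousOn_prod {X : Set α} {f g : α → β} (hf : DigContinuousOn A B X f)
    (hg : DigContinuousOn A B X g) :
    DigContinuousOn A (prodAdj B) X fun x => (f x, g x) := by
  intro x hx x' hx' ha
  by_cases he : (f x, g x) = (f x', g x')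
  · exact Or.inl he
  · exact Or.inr ⟨he, hf x hx x' hx' ha, hg x hx x' hx' ha⟩

theorem DigPath.eval_of_len_le (p : DigPath α) {t : ℤ} (h : (p.len : ℤ) ≤ t) :
    p.eval t = p.toFun p.len := by
  rw [DigPath.eval, min_eq_right h]

/-- On a finite image, a motion planner over `U` may be taken with all paths of the same
length, which makes it a homotopy between the two projections. -/
theorem tcle_iff {X : Set α} (hX : X.Finite) (k : ℕ) :
    TCle A X k ↔ ∃ U : Fin k → Set (α × α), (⋃ j, U j) = X ×ˢ X ∧
      ∀ j, DigHomotopic (prodAdj A) A (U j) X Prod.fst Prod.snd := by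
  refine exists_congr fun U => and_congr_right fun hU => forall_congr' fun j => ⟨?_, ?_⟩
  · rintro ⟨s, hp, hc, he⟩
    have hfin : (U j).Finite :=
      (hX.prod hX).subset (hU ▸ Set.subset_iUnion U j)
    obtain ⟨L, hL⟩ : ∃ L : ℕ, ∀ u ∈ U j, (s u).len ≤ L := by
      obtain ⟨L, hL⟩ := (hfin.image fun u => (s u).len).bddAbove
      exact ⟨L, fun u hu => hL ⟨u, hu, rfl⟩⟩
    have hmin : ∀ u, ∀ t ∈ Set.Icc (0 : ℤ) L, min t ((s u).len : ℤ) ∈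
        Set.Icc (0 : ℤ) (s u).len := by
      intro u t ht
      rw [Set.mem_Icc] at ht ⊢
      omega
    refine ⟨L, fun u t => (s u).eval t, ?_, ?_, ?_, ?_, ?_⟩
    · intro u hu t ht
      exact (hp u hu).1 _ (hmin u t ht)
    · intro u hu
      simp only [← (he u hu).1, DigPath.eval, min_eq_left (show (0 : ℤ) ≤ (s u).len by omega)]
    · intro u hu
      exact ((s u).eval_of_len_le (by exact_mod_cast hL u hu)).trans (he u hu).2
    · intro t ht u hu v hv ha
      rcases hc u hu v hv ha with h | h
      · exact Or.inl (congrArg (DigPath.eval · t) h)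
      · rw [Set.mem_Icc] at ht
        by_cases hle : t ≤ ((max (s u).len (s v).len : ℕ) : ℤ)
        · exact h t ⟨ht.1, hle⟩
        · have := h _ ⟨by omega, le_refl _⟩
          simp only [DigPath.eval_of_len_le (s u) (t := t) (by omega),
            DigPath.eval_of_len_le (s v) (t := t) (by omega)]
          rwa [DigPath.eval_of_len_le (s u) (by omega),
            DigPath.eval_of_len_le (s v) (by omega)] at this
    · intro u hu t ht t' ht' ha
      by_cases heq : min t ((s u).len : ℤ) = min t' ((s u).len : ℤ)
      · exact Or.inl (congrArg (s u).toFun heq)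
      · refine (hp u hu).2 _ (hmin u t ht) _ (hmin u t' ht') ?_
        rw [adjZ_iff] at ha ⊢
        omega
  · rintro ⟨L, F, h1, h2, h3, h4, h5⟩
    refine ⟨fun u => ⟨L, F u⟩, fun u hu => ⟨h1 u hu, h5 u hu⟩, ?_,
      fun u hu => ⟨h2 u hu, h3 u hu⟩⟩
    intro u hu v hv ha
    refine Or.inr fun t ht => ?_
    rw [Set.mem_Icc, max_self] at ht
    simp only [DigPath.eval, min_eq_left ht.2]
    exact h4 t ht u hu v hv ha

theorem TCle.of_dominated {X : Set α} {Y : Set β} (hX : X.Finite) (hY : Y.Finite)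
    {f : α → β} {g : β → α} (hfm : DigMapsTo X Y f) (hfc : DigContinuousOn A B X f)
    (hgm : DigMapsTo Y X g) (hgc : DigContinuousOn B A Y g)
    (h : DigHomotopic A A X X (g ∘ f) id) {k : ℕ} (hk : TCle B Y k) : TCle A X k := by
  rw [tcle_iff hY] at hk
  rw [tcle_iff hX]
  obtain ⟨U, hU, hs⟩ := hk
  refine ⟨fun j => {u | u ∈ X ×ˢ X ∧ (f u.1, f u.2) ∈ U j}, ?_, fun j => ?_⟩
  · ext u
    simp only [Set.mem_iUnion, Set.mem_ofPred_eq, exists_and_left, and_iff_left_iff_imp]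
    intro hu
    rw [← Set.mem_iUnion, hU]
    exact ⟨hfm _ hu.1, hfm _ hu.2⟩
  · set V : Set (α × α) := {u | u ∈ X ×ˢ X ∧ (f u.1, f u.2) ∈ U j} with hV
    have fst_m : DigMapsTo V X Prod.fst := fun u hu => hu.1.1
    have snd_m : DigMapsTo V X Prod.snd := fun u hu => hu.1.2
    have hc : DigContinuousOn (prodAdj A) (prodAdj B) V fun u => (f u.1, f u.2) :=
      digContinuousOn_prod (digContinuousOn_comp fst_m (digContinuousOn_fst V) hfc)
        (digContinuousOn_comp snd_m (digContinuousOn_snd V) hfc)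
    have hmid := ((hs j).precomp (h := fun u : α × α => (f u.1, f u.2)) (fun u hu => hu.2)
      hc).postcomp hgm hgc
    exact (h.precomp fst_m (digContinuousOn_fst V)).symm.trans
      (hmid.trans (h.precomp snd_m (digContinuousOn_snd V)))

theorem DigHomotopyEquiv.digTC_eq {X : Set α} {Y : Set β} (hX : X.Finite) (hY : Y.Finite)
    (h : DigHomotopyEquiv A B X Y) : digTC A X = digTC B Y := by
  obtain ⟨f, hfm, hfc, g, hgm, hgc, hgf, hfg⟩ := h
  have : ∀ k, TCle A X k ↔ TCle B Y k := fun k =>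
    ⟨TCle.of_dominated hY hX hgm hgc hfm hfc hfg, TCle.of_dominated hX hY hfm hfc hgm hgc hgf⟩
  simp only [digTC, this]

theorem not_tcle_zero {X : Set α} (hX : X.Nonempty) : ¬ TCle A X 0 := by
  rintro ⟨U, hU, -⟩
  obtain ⟨x, hx⟩ := hX
  have : (x, x) ∈ ⋃ j, U j := hU ▸ ⟨hx, hx⟩
  simp at this

theorem TCle.homotopic {X : Set α} (hX : X.Finite) (h : TCle A X 1) :
    DigHomotopic (prodAdj A) A (X ×ˢ X) X Prod.fst Prod.snd := by
  obtain ⟨U, hU, hs⟩ := (tcle_iff hX 1).1 h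
  have h0 : ⋃ j, U j = U 0 := by
    ext
    simp
  rw [← hU, h0]
  exact hs 0

theorem digTC_eq_one {X : Set α} (hX : X.Nonempty) (h : TCle A X 1) : digTC A X = 1 := by
  refine le_antisymm (sInf_le ⟨1, rfl, h⟩) (le_sInf ?_)
  rintro _ ⟨k, rfl, hk⟩
  have : k ≠ 0 := by
    rintro rfl
    exact not_tcle_zero hX hk
  exact_mod_cast Nat.one_le_iff_ne_zero.2 this

theorem digTC_eq_two {X : Set α} (hX : X.Nonempty) (h : TCle A X 2) (h1 : ¬ TCle A X 1) :
    digTC A X = 2 := by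
  refine le_antisymm (sInf_le ⟨2, rfl, h⟩) (le_sInf ?_)
  rintro _ ⟨k, rfl, hk⟩
  have h0' : k ≠ 0 := by
    rintro rfl
    exact not_tcle_zero hX hk
  have h1' : k ≠ 1 := by
    rintro rfl
    exact h1 hk
  have : 2 ≤ k := by omega
  exact_mod_cast this

end Homotopy

section Cycle

theorem eq_or_cmAdj {m : ℕ} {i j : ZMod m} (h : j = i ∨ j = i + 1 ∨ i = j + 1) :
    i = j ∨ cmAdj m i j := by
  by_cases he : i = j
  · exact Or.inl he
  · exact Or.inr ⟨he, h.resolve_left fun h' => he h'.symm⟩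

theorem eq_or_cmAdj_iff_exists_int {m : ℕ} {i j : ZMod m} :
    (i = j ∨ cmAdj m i j) ↔ ∃ e : ℤ, |e| ≤ 1 ∧ j = i + e := by
  constructor
  · rintro (h | ⟨-, h | h⟩)
    · exact ⟨0, by simp, by simp [h]⟩
    · exact ⟨1, by simp, by simp [h]⟩
    · exact ⟨-1, by simp, by simp [h]⟩
  · rintro ⟨e, he, h⟩
    have : e = 0 ∨ e = 1 ∨ e = -1 := by
      rw [abs_le] at he
      omega
    apply eq_or_cmAdj
    rcases this with rfl | rfl | rfl
    · exact Or.inl (by simpa using h)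
    · exact Or.inr (Or.inl (by simpa using h))
    · exact Or.inr (Or.inr (by simp [h]))

theorem abs_valMinAbs_sub_le_one {m : ℕ} (hm : 3 ≤ m) {i j : ZMod m}
    (h : i = j ∨ cmAdj m i j) : |(j - i).valMinAbs| ≤ 1 := by
  have : NeZero m := ⟨by omega⟩
  obtain ⟨e, he, rfl⟩ := eq_or_cmAdj_iff_exists_int.1 h
  rw [add_sub_cancel_left]
  have he' := abs_le.1 he
  rwa [(ZMod.valMinAbs_spec (e : ZMod m) e).2 ⟨rfl, by constructor <;> omega⟩]

/-- The winding number of a self-map of the digital cycle. -/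
noncomputable def windingSum (m : ℕ) [NeZero m] (g : ZMod m → ZMod m) : ℤ :=
  ∑ i, (g (i + 1) - g i).valMinAbs

theorem windingSum_congr {m : ℕ} [NeZero m] (hm : 5 ≤ m) {g g' : ZMod m → ZMod m}
    (hg : DigContinuousOn (cmAdj m) (cmAdj m) Set.univ g)
    (hg' : DigContinuousOn (cmAdj m) (cmAdj m) Set.univ g')
    (h : ∀ i, g i = g' i ∨ cmAdj m (g i) (g' i)) : windingSum m g = windingSum m g' := by
  have hsucc : ∀ {k : ZMod m → ZMod m}, DigContinuousOn (cmAdj m) (cmAdj m) Set.univ k →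
      ∀ i, |(k (i + 1) - k i).valMinAbs| ≤ 1 := by
    intro k hk i
    apply abs_valMinAbs_sub_le_one (by omega)
    rcases eq_or_cmAdj (i := i) (j := i + 1) (Or.inr (Or.inl rfl)) with he | he
    · exact Or.inl (congrArg k he)
    · exact hk _ trivial _ trivial he
  set e : ZMod m → ℤ := fun i => (g' i - g i).valMinAbs with he
  have he1 : ∀ i, |e i| ≤ 1 := fun i => abs_valMinAbs_sub_le_one (by omega) (h i)
  have key : ∀ i, (g' (i + 1) - g' i).valMinAbs =
      (g (i + 1) - g i).valMinAbs + (e (i + 1) - e i) := by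
    intro i
    have a1 := abs_le.1 (hsucc hg i)
    have a2 := abs_le.1 (hsucc hg' i)
    have a3 := abs_le.1 (he1 i)
    have a4 := abs_le.1 (he1 (i + 1))
    refine sub_eq_zero.1 (Int.eq_zero_of_abs_lt_dvd (m := (m : ℤ)) ?_ ?_)
    · rw [← ZMod.intCast_zmod_eq_zero_iff_dvd]
      simp only [he]
      push_cast [ZMod.coe_valMinAbs]
      ring
    · rw [abs_lt]
      constructor <;> omega
  have hshift : ∑ i, e (i + 1) = ∑ i, e i := Equiv.sum_comp (Equiv.addRight (1 : ZMod m)) e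
  unfold windingSum
  rw [Finset.sum_congr rfl fun i _ => key i, Finset.sum_add_distrib, Finset.sum_sub_distrib,
    hshift, sub_self, add_zero]

theorem not_homotopic_id_const {m : ℕ} [NeZero m] (hm : 5 ≤ m) (c : ZMod m) :
    ¬ DigHomotopic (cmAdj m) (cmAdj m) Set.univ Set.univ id fun _ => c := by
  rintro ⟨L, F, -, h2, h3, h4, h5⟩
  have hconst : ∀ n : ℕ, n ≤ L →
      windingSum m (fun i => F i (n : ℤ)) = windingSum m fun i => F i 0 := by
    intro n
    induction n with
    | zero => simp
    | succ n ih =>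
      intro hn
      rw [← ih (by omega)]
      have hn0 : ((n : ℕ) : ℤ) ∈ Set.Icc (0 : ℤ) L := ⟨by omega, by omega⟩
      have hn1 : ((n + 1 : ℕ) : ℤ) ∈ Set.Icc (0 : ℤ) L := ⟨by omega, by omega⟩
      refine windingSum_congr hm (h4 _ hn1) (h4 _ hn0) fun i => h5 i trivial _ hn1 _ hn0 ?_
      simp [adjZ]
  have h := hconst L le_rfl
  have h1 : (1 : ZMod m).valMinAbs = 1 :=
    (ZMod.valMinAbs_spec _ _).2 ⟨by simp, by constructor <;> omega⟩
  simp only [h2 _ trivial, h3 _ trivial, windingSum, id, sub_self, add_sub_cancel_left, h1,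
    ZMod.valMinAbs_zero, Finset.sum_const, Finset.card_univ, ZMod.card] at h
  simp at h
  omega

theorem not_tcle_one_cycle {m : ℕ} [NeZero m] (hm : 5 ≤ m) :
    ¬ TCle (cmAdj m) (Set.univ : Set (ZMod m)) 1 := by
  intro h
  refine not_homotopic_id_const hm 0 ((h.homotopic Set.finite_univ).precomp
    (h := fun x : ZMod m => (x, (0 : ZMod m))) (fun _ _ => ⟨trivial, trivial⟩) ?_)
  exact digContinuousOn_prod (fun _ _ _ _ h => Or.inr h) fun _ _ _ _ _ => Or.inl rfl

/-- Going around the cycle in the positive direction is a motion planner on the pairs of points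
at positive distance at most `m - 3`. -/
theorem homotopic_fst_snd_of_val_le (m : ℕ) [NeZero m] :
    DigHomotopic (prodAdj (cmAdj m)) (cmAdj m)
      {u : ZMod m × ZMod m | (u.2 - u.1).val + 3 ≤ m} Set.univ Prod.fst Prod.snd := by
  refine ⟨m, fun u t => u.1 + ((min t ((u.2 - u.1).val : ℤ) : ℤ) : ZMod m),
    fun _ _ _ _ => trivial, ?_, ?_, ?_, ?_⟩
  · intro u _
    simp only
    rw [min_eq_left (by omega)]
    simp
  · intro u hu
    rw [Set.mem_ofPred_eq] at hu
    simp only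
    rw [min_eq_right (by omega)]
    simp
  · rintro t - u hu v hv ⟨-, h1, h2⟩
    rw [Set.mem_ofPred_eq] at hu hv
    obtain ⟨a, ha, h1⟩ := eq_or_cmAdj_iff_exists_int.1 h1
    obtain ⟨b, hb, h2⟩ := eq_or_cmAdj_iff_exists_int.1 h2
    rw [abs_le] at ha hb
    have hd : ((v.2 - v.1).val : ℤ) = (u.2 - u.1).val + b - a := by
      refine sub_eq_zero.1 (Int.eq_zero_of_abs_lt_dvd (m := (m : ℤ)) ?_ ?_)
      · rw [← ZMod.intCast_zmod_eq_zero_iff_dvd]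
        push_cast [ZMod.natCast_zmod_val]
        rw [h1, h2]
        ring
      · rw [abs_lt]
        constructor <;> omega
    refine eq_or_cmAdj_iff_exists_int.2
      ⟨a + min t ((v.2 - v.1).val : ℤ) - min t ((u.2 - u.1).val : ℤ), ?_, ?_⟩
    · rw [abs_le]
      constructor <;> omega
    · simp only
      rw [h1]
      push_cast
      ring
  · intro u _ t _ t' _ ha
    rw [adjZ_iff] at ha
    refine eq_or_cmAdj_iff_exists_int.2
      ⟨min t' ((u.2 - u.1).val : ℤ) - min t ((u.2 - u.1).val : ℤ), ?_, ?_⟩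
    · rw [abs_le]
      constructor <;> omega
    · push_cast
      ring

theorem tcle_two_cycle {m : ℕ} [NeZero m] (hm : 5 ≤ m) :
    TCle (cmAdj m) (Set.univ : Set (ZMod m)) 2 := by
  rw [tcle_iff Set.finite_univ]
  refine ⟨![{u | (u.2 - u.1).val + 3 ≤ m}, {u | (u.1 - u.2).val + 3 ≤ m}], ?_, ?_⟩
  · refine Set.eq_univ_of_forall (fun u => ?_) |>.trans Set.univ_prod_univ.symm
    rw [Set.mem_iUnion, Fin.exists_fin_two]
    change (u.2 - u.1).val + 3 ≤ m ∨ (u.1 - u.2).val + 3 ≤ m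
    rw [← neg_sub u.2 u.1, ZMod.neg_val]
    split_ifs <;> omega
  · rw [Fin.forall_fin_two]
    have h := homotopic_fst_snd_of_val_le m
    refine ⟨h, ?_⟩
    refine (h.precomp (h := Prod.swap) (Z := {u | (u.1 - u.2).val + 3 ≤ m}) (fun u hu => hu)
      ?_).symm
    exact digContinuousOn_prod (digContinuousOn_snd _) (digContinuousOn_fst _)

theorem TCle.of_homotopic_const {α : Type} {A : α → α → Prop} {X : Set α} (hX : X.Finite) {c : α}
    (h : DigHomotopic A A X X id fun _ => c) : TCle A X 1 := by
  rw [tcle_iff hX]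
  refine ⟨fun _ => X ×ˢ X, Set.iUnion_const _, fun _ => ?_⟩
  exact (h.precomp (fun u hu => hu.1) (digContinuousOn_fst _)).trans
    (h.precomp (h := Prod.snd) (fun u hu => hu.2) (digContinuousOn_snd _)).symm

theorem tcle_one_cycle_four : TCle (cmAdj 4) (Set.univ : Set (ZMod 4)) 1 := by
  set r : ZMod 4 → ZMod 4 := fun i => if i = 1 then 0 else if i = 2 then 3 else i with hr
  refine TCle.of_homotopic_const (c := 0) Set.finite_univ
    ⟨2, fun i t => if t = 0 then i else if t = 1 then r i else 0,
      fun _ _ _ _ => trivial, fun _ _ => rfl, fun _ _ => rfl, ?_, ?_⟩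
  · have h0 : ∀ i j : ZMod 4, (j = i + 1 ∨ i = j + 1) →
        r j = r i ∨ r j = r i + 1 ∨ r i = r j + 1 := by decide
    intro t _ i _ j _ ha
    dsimp only
    split_ifs
    · exact Or.inr ha
    · exact eq_or_cmAdj (h0 i j ha.2)
    · exact Or.inl rfl
  · have h1 : ∀ i : ZMod 4, r i = i ∨ r i = i + 1 ∨ i = r i + 1 := by decide
    have h2 : ∀ i : ZMod 4, 0 = r i ∨ 0 = r i + 1 ∨ r i = 0 + 1 := by decide
    intro i _ t ht t' ht' ha
    have ht2 : 0 ≤ t ∧ t ≤ 2 := ht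
    have ht2' : 0 ≤ t' ∧ t' ≤ 2 := ht'
    rw [adjZ_iff] at ha
    have : (t = 0 ∧ t' = 1) ∨ (t = 1 ∧ t' = 0) ∨ (t = 1 ∧ t' = 2) ∨ (t = 2 ∧ t' = 1) := by
      omega
    rcases this with ⟨rfl, rfl⟩ | ⟨rfl, rfl⟩ | ⟨rfl, rfl⟩ | ⟨rfl, rfl⟩
    · exact eq_or_cmAdj (h1 i)
    · exact eq_or_cmAdj ((h1 i).imp Eq.symm Or.symm)
    · exact eq_or_cmAdj (h2 i)
    · exact eq_or_cmAdj ((h2 i).imp Eq.symm Or.symm)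

end Cycle

section Curve

variable {α : Type} {A : α → α → Prop}

theorem IsSimpleClosedCurve.finite {C : Set α} {m : ℕ} (hC : IsSimpleClosedCurve A C m) :
    C.Finite := by
  obtain ⟨-, f, rfl, -⟩ := hC
  exact (Set.finite_Icc _ _).image f

theorem IsSimpleClosedCurve.digHomotopyEquiv (hsymm : ∀ a b, A a b → A b a) {C : Set α} {m : ℕ}
    (hC : IsSimpleClosedCurve A C m) :
    DigHomotopyEquiv A (cmAdj m) C (Set.univ : Set (ZMod m)) := by
  obtain ⟨hm, f, rfl, hinj, hcont, hends, hadj⟩ := hC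
  have : NeZero m := ⟨by omega⟩
  set I : Set ℤ := Set.Icc 0 ((m : ℤ) - 1) with hI
  set g : ZMod m → α := fun i => f i.val with hg
  set p : α → ZMod m := fun x => ((Function.invFunOn f I x : ℤ) : ZMod m) with hp
  have hval : ∀ i : ZMod m, (i.val : ℤ) ∈ I := fun i =>
    ⟨by omega, by have := ZMod.val_lt i; omega⟩
  have hpf : ∀ t ∈ I, p (f t) = t := fun t ht => by
    rw [hp]
    simp only
    rw [hinj.leftInvOn_invFunOn ht]
  have hmod : ∀ t : ℤ, t % (m : ℤ) ∈ I := fun t =>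
    ⟨Int.emod_nonneg _ (by omega), by
      have := Int.emod_lt_of_pos t (show (0 : ℤ) < m by omega)
      omega⟩
  have hpmod : ∀ t : ℤ, p (f (t % m)) = t := fun t => by
    rw [hpf _ (hmod t), ZMod.intCast_mod]
  have hpg : ∀ i, p (g i) = i := fun i => by
    rw [hg]
    simp only
    rw [hpf _ (hval i)]
    simp
  have hgp : ∀ x ∈ f '' I, g (p x) = x := by
    rintro _ ⟨t, ht, rfl⟩
    rw [hpf t ht]
    simp only [hg]
    rw [ZMod.val_intCast, Int.emod_eq_of_lt ht.1 (by have := ht.2; omega)]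
  have hpc : DigContinuousOn A (cmAdj m) (f '' I) p := by
    rintro _ ⟨t, ht, rfl⟩ _ ⟨t', ht', rfl⟩ ha
    apply eq_or_cmAdj
    rcases hadj t ht t' ht' ha with h | h
    · rw [h, hpmod, hpf t ht]
      exact Or.inr (Or.inr (by push_cast; ring))
    · rw [h, hpmod, hpf t ht]
      exact Or.inr (Or.inl (by push_cast; ring))
  have hstep : ∀ i : ZMod m, (g i = g (i + 1) ∨ A (g i) (g (i + 1))) ∧
      (g (i + 1) = g i ∨ A (g (i + 1)) (g i)) := by
    intro i
    have hlt := ZMod.val_lt i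
    have hv := ZMod.val_add i 1
    rw [ZMod.val_one_eq_one_mod, Nat.add_mod_mod] at hv
    by_cases hw : i.val + 1 < m
    · rw [Nat.mod_eq_of_lt hw] at hv
      have h1 := hcont _ (hval i) _ (hval (i + 1)) (by simp [adjZ, hv])
      have h2 := hcont _ (hval (i + 1)) _ (hval i) (by simp [adjZ, hv])
      exact ⟨h1, h2⟩
    · have hi : (i.val : ℤ) = m - 1 := by omega
      rw [show i.val + 1 = m by omega, Nat.mod_self] at hv
      simp only [hg, hv, hi]
      exact ⟨Or.inr (hsymm _ _ hends), Or.inr hends⟩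
  have hgc : DigContinuousOn (cmAdj m) A Set.univ g := by
    rintro i - j - ⟨-, rfl | rfl⟩
    · exact (hstep i).1
    · exact (hstep j).2
  have hgm : DigMapsTo Set.univ (f '' I) g := fun i _ => ⟨_, hval i, rfl⟩
  have hpm : DigMapsTo (f '' I) Set.univ p := fun _ _ => trivial
  refine ⟨p, hpm, hpc, g, hgm, hgc, ?_, ?_⟩
  · exact .of_eqOn (fun x hx => hgm _ trivial) (digContinuousOn_comp hpm hpc hgc) hgp
  · exact .of_eqOn (fun _ _ => trivial) (digContinuousOn_comp hgm hgc hpc) fun i _ => hpg i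

theorem IsSimpleClosedCurve.digTC_eq (hsymm : ∀ a b, A a b → A b a) {C : Set α} {m : ℕ}
    (hC : IsSimpleClosedCurve A C m) : digTC A C = if m = 4 then 1 else 2 := by
  have hm : 4 ≤ m := hC.1
  have : NeZero m := ⟨by omega⟩
  rw [(hC.digHomotopyEquiv hsymm).digTC_eq hC.finite Set.finite_univ]
  split_ifs with h4
  · subst h4
    exact digTC_eq_one Set.univ_nonempty tcle_one_cycle_four
  · exact digTC_eq_two Set.univ_nonempty (tcle_two_cycle (by omega)) (not_tcle_one_cycle (by omega))

/-- The consecutive vertices of a simple closed curve are adjacent, and no others are. -/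
theorem IsSimpleClosedCurve.exists_vertices {C : Set α} {m : ℕ}
    (hC : IsSimpleClosedCurve A C m) : ∃ f : ℤ → α,
      (∀ t : ℤ, 0 ≤ t → t + 1 < m → A (f t) (f (t + 1))) ∧ A (f 0) (f ((m : ℤ) - 1)) ∧
      ∀ t t' : ℤ, 0 ≤ t → t + 2 ≤ t' → t' < m → ¬ (t = 0 ∧ t' = m - 1) →
        f t ≠ f t' ∧ ¬ A (f t) (f t') := by
  obtain ⟨hm, f, -, hinj, hcont, hends, hadj⟩ := hC
  refine ⟨f, ?_, hends, ?_⟩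
  · intro t h0 h1
    have ht : t ∈ Set.Icc (0 : ℤ) ((m : ℤ) - 1) := ⟨by omega, by omega⟩
    have ht' : t + 1 ∈ Set.Icc (0 : ℤ) ((m : ℤ) - 1) := ⟨by omega, by omega⟩
    refine (hcont t ht _ ht' (by simp [adjZ])).resolve_left fun h => ?_
    have := hinj ht ht' h
    omega
  · intro t t' h0 h2 h3 hne
    have ht : t ∈ Set.Icc (0 : ℤ) ((m : ℤ) - 1) := ⟨by omega, by omega⟩
    have ht' : t' ∈ Set.Icc (0 : ℤ) ((m : ℤ) - 1) := ⟨by omega, by omega⟩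
    refine ⟨fun h => ?_, fun h => ?_⟩
    · have := hinj ht ht' h
      omega
    · have hmem : ∀ s : ℤ, s % (m : ℤ) ∈ Set.Icc (0 : ℤ) ((m : ℤ) - 1) := fun s =>
        ⟨Int.emod_nonneg _ (by omega), by
          have := Int.emod_lt_of_pos s (show (0 : ℤ) < m by omega)
          omega⟩
      rcases hadj t ht t' ht' h with h | h
      · have he := hinj ht' (hmem _) h
        rcases h0.eq_or_lt with rfl | hpos
        · rw [show (0 - 1 : ℤ) = (m - 1) - m by ring, Int.sub_emod_right,
            Int.emod_eq_of_lt (by omega) (by omega)] at he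
          exact hne ⟨rfl, he⟩
        · rw [Int.emod_eq_of_lt (by omega) (by omega)] at he
          omega
      · have he := hinj ht' (hmem _) h
        rw [Int.emod_eq_of_lt (by omega) (by omega)] at he
        omega

end Curve

section Plane

theorem adj4_iff {p q : ℤ × ℤ} : adj4 p q ↔
    (q.1 = p.1 + 1 ∧ q.2 = p.2) ∨ (q.1 = p.1 - 1 ∧ q.2 = p.2) ∨
      (q.1 = p.1 ∧ q.2 = p.2 + 1) ∨ (q.1 = p.1 ∧ q.2 = p.2 - 1) := by
  rw [adj4, abs_eq zero_le_one, abs_eq zero_le_one]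
  omega

theorem adj4_symm (p q : ℤ × ℤ) (h : adj4 p q) : adj4 q p := by
  rw [adj4_iff] at h ⊢
  omega

theorem adj8_symm (p q : ℤ × ℤ) (h : adj8 p q) : adj8 q p :=
  ⟨h.1.symm, abs_sub_comm p.1 q.1 ▸ h.2.1, abs_sub_comm p.2 q.2 ▸ h.2.2⟩

theorem adj4_parity {p q : ℤ × ℤ} (h : adj4 p q) : (p.1 + p.2 + q.1 + q.2) % 2 = 1 := by
  rw [adj4_iff] at h
  omega

theorem not_isSimpleClosedCurve_adj4_five (C : Set (ℤ × ℤ)) :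
    ¬ IsSimpleClosedCurve adj4 C 5 := by
  intro hC
  obtain ⟨f, hs, he, -⟩ := hC.exists_vertices
  have h0 := adj4_parity (hs 0 (by norm_num) (by norm_num))
  have h1 := adj4_parity (hs 1 (by norm_num) (by norm_num))
  have h2 := adj4_parity (hs 2 (by norm_num) (by norm_num))
  have h3 := adj4_parity (hs 3 (by norm_num) (by norm_num))
  have h4 := adj4_parity he
  norm_num at h0 h1 h2 h3 h4
  omega

theorem not_isSimpleClosedCurve_adj4_seven (C : Set (ℤ × ℤ)) :
    ¬ IsSimpleClosedCurve adj4 C 7 := by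
  intro hC
  obtain ⟨f, hs, he, -⟩ := hC.exists_vertices
  have h0 := adj4_parity (hs 0 (by norm_num) (by norm_num))
  have h1 := adj4_parity (hs 1 (by norm_num) (by norm_num))
  have h2 := adj4_parity (hs 2 (by norm_num) (by norm_num))
  have h3 := adj4_parity (hs 3 (by norm_num) (by norm_num))
  have h4 := adj4_parity (hs 4 (by norm_num) (by norm_num))
  have h5 := adj4_parity (hs 5 (by norm_num) (by norm_num))
  have h6 := adj4_parity he
  norm_num at h0 h1 h2 h3 h4 h5 h6
  omega

set_option maxHeartbeats 1600000 in
theorem not_isSimpleClosedCurve_adj4_six (C : Set (ℤ × ℤ)) :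
    ¬ IsSimpleClosedCurve adj4 C 6 := by
  intro hC
  obtain ⟨f, hs, he, hn⟩ := hC.exists_vertices
  have h0 := hs 0 (by norm_num) (by norm_num)
  have h1 := hs 1 (by norm_num) (by norm_num)
  have h2 := hs 2 (by norm_num) (by norm_num)
  have h3 := hs 3 (by norm_num) (by norm_num)
  have h4 := hs 4 (by norm_num) (by norm_num)
  have n02 := (hn 0 2 (by norm_num) (by norm_num) (by norm_num) (by norm_num)).1
  have n13 := (hn 1 3 (by norm_num) (by norm_num) (by norm_num) (by norm_num)).1
  have n24 := (hn 2 4 (by norm_num) (by norm_num) (by norm_num) (by norm_num)).1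
  have n35 := (hn 3 5 (by norm_num) (by norm_num) (by norm_num) (by norm_num)).1
  have n03 := (hn 0 3 (by norm_num) (by norm_num) (by norm_num) (by norm_num)).2
  have n14 := (hn 1 4 (by norm_num) (by norm_num) (by norm_num) (by norm_num)).2
  have n25 := (hn 2 5 (by norm_num) (by norm_num) (by norm_num) (by norm_num)).2
  norm_num at h0 h1 h2 h3 h4 he
  generalize f 0 = p0 at *
  generalize f 1 = p1 at *
  generalize f 2 = p2 at *
  generalize f 3 = p3 at *
  generalize f 4 = p4 at *
  generalize f 5 = p5 at *
  rw [adj4_iff] at *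
  rw [Ne, Prod.ext_iff] at n02 n13 n24 n35
  rcases h0 with h0 | h0 | h0 | h0 <;> rcases h1 with h1 | h1 | h1 | h1 <;>
    try (exfalso; clear h2 h3 h4 he n13 n24 n35 n03 n14 n25; omega)
  all_goals
    rcases h2 with h2 | h2 | h2 | h2 <;> try (exfalso; clear h3 h4 he n24 n35 n14 n25; omega)
  all_goals
    rcases h3 with h3 | h3 | h3 | h3 <;> try (exfalso; clear h4 he n35 n25; omega)
  all_goals omega

theorem adj8_step {p q : ℤ × ℤ} (h : adj8 p q) :
    (-1 ≤ q.1 - p.1 ∧ q.1 - p.1 ≤ 1) ∧ (-1 ≤ q.2 - p.2 ∧ q.2 - p.2 ≤ 1) := by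
  have h1 := abs_le.1 h.2.1
  have h2 := abs_le.1 h.2.2
  omega

theorem not_adj8_cases {p q : ℤ × ℤ} (h : p ≠ q ∧ ¬ adj8 p q) :
    (2 ≤ q.1 - p.1 ∨ q.1 - p.1 ≤ -2) ∨ (2 ≤ q.2 - p.2 ∨ q.2 - p.2 ≤ -2) := by
  by_contra! hc
  exact h.2 ⟨h.1, abs_le.2 (by omega), abs_le.2 (by omega)⟩

theorem not_isSimpleClosedCurve_adj8_five (C : Set (ℤ × ℤ)) :
    ¬ IsSimpleClosedCurve adj8 C 5 := by
  intro hC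
  obtain ⟨f, hs, he, hn⟩ := hC.exists_vertices
  have h0 := adj8_step (hs 0 (by norm_num) (by norm_num))
  have h1 := adj8_step (hs 1 (by norm_num) (by norm_num))
  have h2 := adj8_step (hs 2 (by norm_num) (by norm_num))
  have h3 := adj8_step (hs 3 (by norm_num) (by norm_num))
  have h4 := adj8_step he
  have n02 := not_adj8_cases (hn 0 2 (by norm_num) (by norm_num) (by norm_num) (by norm_num))
  have n13 := not_adj8_cases (hn 1 3 (by norm_num) (by norm_num) (by norm_num) (by norm_num))
  have n24 := not_adj8_cases (hn 2 4 (by norm_num) (by norm_num) (by norm_num) (by norm_num))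
  have n03 := not_adj8_cases (hn 0 3 (by norm_num) (by norm_num) (by norm_num) (by norm_num))
  have n14 := not_adj8_cases (hn 1 4 (by norm_num) (by norm_num) (by norm_num) (by norm_num))
  norm_num at h0 h1 h2 h3 h4
  rcases n02 with n02 | n02 <;> rcases n13 with n13 | n13 <;> rcases n24 with n24 | n24 <;>
    rcases n03 with n03 | n03 <;> rcases n14 with n14 | n14 <;> omega

end Plane

/-- if a κ-connected `X ⊆ ℤ²` with `m` points is digitally homotopy
equivalent to a digital simple closed κ-curve with exactly `m` points, then
`TC(X,4) = 1` for `m < 8`, `TC(X,4) = 2` for `m ≥ 8`, `TC(X,8) = 1` for `m < 6` and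
`TC(X,8) = 2` for `m ≥ 6`. -/
theorem stmt_9 (κ : ℕ) (hκ : κ = 4 ∨ κ = 8) (X : Set (ℤ × ℤ)) (hfin : X.Finite)
    (m : ℕ) (hm : X.ncard = m) (hconn : DigConnected (adjK κ) X)
    (C : Set (ℤ × ℤ)) (hC : IsSimpleClosedCurve (adjK κ) C m)
    (heq : DigHomotopyEquiv (adjK κ) (adjK κ) X C) :
    (κ = 4 → (m < 8 → digTC (adjK κ) X = 1) ∧ (8 ≤ m → digTC (adjK κ) X = 2)) ∧
    (κ = 8 → (m < 6 → digTC (adjK κ) X = 1) ∧ (6 ≤ m → digTC (adjK κ) X = 2)) := by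
  have hm4 : 4 ≤ m := hC.1
  have hsymm : ∀ a b, adjK κ a b → adjK κ b a := by
    rcases hκ with rfl | rfl
    · exact adj4_symm
    · exact adj8_symm
  rw [heq.digTC_eq hfin hC.finite, hC.digTC_eq hsymm]
  constructor
  · rintro rfl
    refine ⟨fun h => if_pos ?_, fun h => if_neg (by omega)⟩
    have h5 : m ≠ 5 := by
      rintro rfl
      exact not_isSimpleClosedCurve_adj4_five C hC
    have h6 : m ≠ 6 := by
      rintro rfl
      exact not_isSimpleClosedCurve_adj4_six C hC
    have h7 : m ≠ 7 := by
      rintro rfl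
      exact not_isSimpleClosedCurve_adj4_seven C hC
    omega
  · rintro rfl
    refine ⟨fun h => if_pos ?_, fun h => if_neg (by omega)⟩
    have h5 : m ≠ 5 := by
      rintro rfl
      exact not_isSimpleClosedCurve_adj8_five C hC
    omega
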